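/- For every ε > 0 there exists a positive integer X₀ such that P(x) ≤ εx for every integer x ≥ X₀ that is not a prime-power. -/

import Mathlib

open scoped Classical

/-- The largest element of ℙ*₁ = ℙ* ∪ {1} (prime-powers together with 1) not exceeding `x`. -/
noncomputable def q (x : ℕ) : ℕ :=
  sSup {m : ℕ | (IsPrimePow m ∨ m = 1) ∧ m ≤ x}

/-- The prime-power map. -/
noncomputable def P (x : ℕ) : ℕ :=
  if x = 1 then 1
  else if IsPrimePow x then x / x.minFac
  else x - q x

/-- The orbit of `x` under `P`: `orbit x 1 = x` and `orbit x (n+1) = P (orbit x n)`. -/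
noncomputable def orbit (x n : ℕ) : ℕ := P^[n - 1] x

/-- The transient length `T x = min {n ≥ 1 : x_n = 1}`. -/
noncomputable def T (x : ℕ) : ℕ := sInf {n : ℕ | 1 ≤ n ∧ orbit x n = 1}

/-- The settling time `S x = min {n ≥ 1 : x_n ∈ ℙ*₁}`. -/
noncomputable def S (x : ℕ) : ℕ :=
  sInf {n : ℕ | 1 ≤ n ∧ (IsPrimePow (orbit x n) ∨ orbit x n = 1)}

open Complex Filter Topology MeasureTheory ArithmeticFunction DirichletCharacter

/-- The continuous extension to `1 ≤ re s` of the L-series of `Λ - 1`. -/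
noncomputable def lseriesExt (s : ℂ) : ℂ :=
  -deriv (LFunctionTrivChar₁ 1) s / LFunctionTrivChar₁ 1 s - dslope (LFunctionTrivChar₁ 1) 1 s

lemma continuousOn_lseriesExt : ContinuousOn lseriesExt {s | 1 ≤ s.re} := by
  refine ContinuousOn.sub ?_ ?_
  · refine (continuousOn_neg_logDeriv_LFunctionTrivChar₁ 1).mono fun s hs ↦ ?_
    by_cases h : s = 1
    · exact .inl h
    · refine .inr ?_
      rw [LFunctionTrivChar, LFunction_modOne_eq]
      exact riemannZeta_ne_zero_of_one_le_re hs
  · have h := differentiable_LFunctionTrivChar₁ 1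
    refine ContinuousOn.mono ?_ (Set.subset_univ _)
    exact (continuousOn_dslope Filter.univ_mem).2 ⟨h.continuous.continuousOn, h 1⟩

lemma lseriesSummable_vonMangoldt_sub_one {s : ℂ} (hs : 1 < s.re) :
    LSeriesSummable (fun n ↦ ((Λ n - 1 : ℝ) : ℂ)) s := by
  have := (LSeriesSummable_vonMangoldt hs).sub (LSeriesSummable_one_iff.2 hs)
  convert this using 1
  ext n
  simp

lemma lseriesExt_eq {s : ℂ} (hs : 1 < s.re) :
    lseriesExt s = LSeries (fun n ↦ ((Λ n - 1 : ℝ) : ℂ)) s := by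
  have h1 : s ≠ 1 := by rintro rfl; simp at hs
  have hz := riemannZeta_ne_zero_of_one_le_re hs.le
  have e : (fun n ↦ ((Λ n - 1 : ℝ) : ℂ)) = (fun n ↦ (Λ n : ℂ)) - 1 := by ext n; simp
  rw [e, LSeries_sub (LSeriesSummable_vonMangoldt hs) (LSeriesSummable_one_iff.2 hs),
    LSeries_vonMangoldt_eq_deriv_riemannZeta_div hs, LSeries_one_eq_riemannZeta hs, lseriesExt,
    deriv_LFunctionTrivChar₁_apply_of_ne_one 1 h1, dslope_of_ne _ h1, slope_def_field]
  have hL : LFunctionTrivChar 1 = riemannZeta := by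
    rw [LFunctionTrivChar, LFunction_modOne_eq]
  have : s - 1 ≠ 0 := sub_ne_zero.2 h1
  simp only [LFunctionTrivChar₁, Function.update_self, Function.update_of_ne h1, hL]
  simp
  field_simp
  ring

/-- The (normalised) Fejér kernel. -/
noncomputable def fejer (u : ℝ) : ℝ := ∫ t in (0 : ℝ)..1, (1 - t) * Real.cos (t * u)

lemma fejer_eq {u : ℝ} (hu : u ≠ 0) : fejer u = (1 - Real.cos u) / u ^ 2 := by
  have h : ∀ t ∈ Set.uIcc (0 : ℝ) 1,
      HasDerivAt (fun t ↦ (1 - t) * Real.sin (t * u) / u - Real.cos (t * u) / u ^ 2)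
        ((1 - t) * Real.cos (t * u)) t := fun t _ ↦ by
    have h0 : HasDerivAt (fun t ↦ t * u) u t := by simpa using (hasDerivAt_id t).mul_const u
    have h1 := (((hasDerivAt_id t).const_sub 1).mul h0.sin).div_const u
    have h2 := h0.cos.div_const (u ^ 2)
    refine (h1.sub h2).congr_deriv ?_
    simp only [id]
    field_simp
    ring
  rw [fejer, intervalIntegral.integral_eq_sub_of_hasDerivAt h
    (Continuous.intervalIntegrable (by fun_prop) _ _)]
  simp
  ring

lemma fejer_zero : fejer 0 = 1 / 2 := by
  have : ∀ t ∈ Set.uIcc (0 : ℝ) 1, HasDerivAt (fun t : ℝ ↦ t - t ^ 2 / 2) (1 - t) t := fun t _ ↦ by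
    refine ((hasDerivAt_id t).sub ((hasDerivAt_pow 2 t).div_const 2)).congr_deriv ?_
    norm_num
  simp only [fejer, mul_zero, Real.cos_zero, mul_one]
  rw [intervalIntegral.integral_eq_sub_of_hasDerivAt this
    (Continuous.intervalIntegrable (by fun_prop) _ _)]
  norm_num

lemma fejer_nonneg (u : ℝ) : 0 ≤ fejer u := by
  rcases eq_or_ne u 0 with rfl | hu
  · norm_num [fejer_zero]
  · rw [fejer_eq hu]
    have := Real.cos_le_one u
    exact div_nonneg (by linarith) (sq_nonneg u)

lemma fejer_le {u : ℝ} (hu : u ≠ 0) : fejer u ≤ 2 / u ^ 2 := by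
  rw [fejer_eq hu]
  have := Real.neg_one_le_cos u
  gcongr
  linarith

lemma fejer_le_half (u : ℝ) : fejer u ≤ 1 / 2 := by
  rcases eq_or_ne u 0 with rfl | hu
  · exact fejer_zero.le
  · rw [fejer_eq hu, div_le_iff₀ (by positivity)]
    linarith [Real.one_sub_sq_div_two_le_cos (x := u)]

lemma quarter_le_fejer {u : ℝ} (hu : |u| ≤ 1) : 1 / 4 ≤ fejer u := by
  rcases eq_or_ne u 0 with rfl | h
  · norm_num [fejer_zero]
  · rw [fejer_eq h, le_div_iff₀ (by positivity)]
    have h1 := (abs_le.1 (Real.cos_bound hu)).2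
    have h2 : |u| ^ 4 ≤ u ^ 2 := by
      rw [← sq_abs u]
      exact pow_le_pow_of_le_one (abs_nonneg u) hu (by norm_num)
    linarith [sq_nonneg u]

/-- The weighted oscillatory integral attached to an L-series. -/
noncomputable def oscIntegral (F : ℂ → ℂ) (lam y σ : ℝ) : ℂ :=
  ∫ t in (0 : ℝ)..1, (1 - t : ℂ) * exp ((t * (lam * y) : ℝ) * I) * F (σ + (lam * t : ℝ) * I)

lemma hasSum_mul_fejer {c : ℕ → ℝ} {σ : ℝ} (hσ : 0 < σ)
    (hc : LSeriesSummable (fun n ↦ (c n : ℂ)) σ) (lam y : ℝ) :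
    HasSum (fun n : ℕ ↦ c n * (n : ℝ) ^ (-σ) * fejer (lam * (y - Real.log n)))
      (oscIntegral (LSeries fun n ↦ (c n : ℂ)) lam y σ).re := by
  set f : ℕ → ℂ := fun n ↦ (c n : ℂ) with hf
  set F : ℕ → ℝ → ℂ := fun n t ↦
    ((c n * (n : ℝ) ^ (-σ) * (1 - t) : ℝ) : ℂ) * exp ((t * (lam * (y - Real.log n)) : ℝ) * I) with hF
  have hterm (n : ℕ) (t : ℝ) : F n t = (1 - t : ℂ) * exp ((t * (lam * y) : ℝ) * I) *
      LSeries.term f (σ + (lam * t : ℝ) * I) n := by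
    rcases eq_or_ne n 0 with rfl | hn
    · simp [hF, Real.zero_rpow (neg_ne_zero.2 hσ.ne')]
    · have hn' : (n : ℂ) ≠ 0 := by exact_mod_cast hn
      have hn0 : (0 : ℝ) < n := by positivity
      rw [LSeries.term_of_ne_zero hn, div_eq_mul_inv, ← cpow_neg, cpow_def_of_ne_zero hn', hF]
      simp only [hf]
      rw [Real.rpow_def_of_pos hn0]
      push_cast
      rw [show (1 - t : ℂ) * cexp (t * (lam * y) * I) *
          (c n * cexp (Complex.log n * -(σ + lam * t * I))) = c n * (1 - t) *
          (cexp (t * (lam * y) * I) * cexp (Complex.log n * -(σ + lam * t * I))) by ring,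
        show (c n : ℂ) * cexp (Complex.log n * -σ) * (1 - t) * cexp (t * (lam * (y - Complex.log n)) * I)
          = c n * (1 - t) *
            (cexp (Complex.log n * -σ) * cexp (t * (lam * (y - Complex.log n)) * I)) by ring,
        ← Complex.exp_add, ← Complex.exp_add]
      congr 2
      ring
  have hnorm (n : ℕ) (t : ℝ) : ‖LSeries.term f (σ + (lam * t : ℝ) * I) n‖
      = ‖LSeries.term f σ n‖ := by
    simp [LSeries.norm_term_eq]
  have hsum (t : ℝ) : HasSum (fun n ↦ F n t) ((1 - t : ℂ) * exp ((t * (lam * y) : ℝ) * I) *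
      LSeries f (σ + (lam * t : ℝ) * I)) := by
    simp only [hterm]
    refine HasSum.mul_left _ (LSeriesSummable.LSeriesHasSum ?_)
    refine Summable.of_norm ?_
    simp only [hnorm]
    exact hc.norm
  have key : HasSum (fun n ↦ ∫ t in (0 : ℝ)..1, F n t)
      (oscIntegral (LSeries f) lam y σ) := by
    refine intervalIntegral.hasSum_integral_of_dominated_convergence
      (fun n _ ↦ ‖LSeries.term f σ n‖) (fun n ↦ ?_) (fun n ↦ ?_) ?_ ?_ ?_
    · exact (Continuous.aestronglyMeasurable (by simp only [hF]; fun_prop))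
    · refine .of_forall fun t ht ↦ ?_
      rw [Set.uIoc_of_le zero_le_one] at ht
      rw [hterm, norm_mul, norm_mul, norm_exp_ofReal_mul_I, mul_one, hnorm]
      refine mul_le_of_le_one_left (norm_nonneg _) ?_
      rw [← ofReal_one, ← ofReal_sub, norm_real, Real.norm_eq_abs, abs_le]
      constructor <;> linarith [ht.1, ht.2]
    · exact .of_forall fun _ _ ↦ hc.norm
    · exact intervalIntegrable_const
    · exact .of_forall fun t _ ↦ hsum t
  convert hasSum_re key using 2 with n
  rw [fejer, ← intervalIntegral.integral_const_mul]
  have hint : IntervalIntegrable (F n) volume 0 1 :=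
    Continuous.intervalIntegrable (by simp only [hF]; fun_prop) _ _
  have := reCLM.intervalIntegral_comp_comm hint
  simp only [reCLM_apply] at this
  rw [← this]
  refine intervalIntegral.integral_congr fun t _ ↦ ?_
  simp only [hF, re_ofReal_mul, exp_ofReal_mul_I_re]
  ring

lemma tendsto_oscIntegral_atTop {lam : ℝ} (hlam : 0 < lam) :
    Tendsto (fun y ↦ oscIntegral lseriesExt lam y 1) atTop (𝓝 0) := by
  set g : ℝ → ℂ := (Set.Ioc (0 : ℝ) 1).indicator
    fun t ↦ (1 - t : ℂ) * lseriesExt (1 + (lam * t : ℝ) * I) with hg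
  have h := Real.tendsto_integral_exp_smul_cocompact g
  have h2 : Tendsto (fun y : ℝ ↦ -(lam * y / (2 * Real.pi))) atTop (cocompact ℝ) := by
    refine Tendsto.mono_right ?_ atBot_le_cocompact
    refine tendsto_neg_atTop_atBot.comp ?_
    exact (tendsto_id.const_mul_atTop hlam).atTop_div_const (by positivity)
  refine (h.comp h2).congr fun y ↦ ?_
  simp only [Function.comp, oscIntegral]
  rw [intervalIntegral.integral_of_le zero_le_one, ← integral_indicator measurableSet_Ioc]
  congr 1
  ext t
  by_cases ht : t ∈ Set.Ioc (0 : ℝ) 1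
  · simp only [hg, Set.indicator_of_mem ht, Circle.smul_def, Real.fourierChar_apply, smul_eq_mul]
    rw [ofReal_one]
    have : 2 * Real.pi * -(t * -(lam * y / (2 * Real.pi))) = t * (lam * y) := by
      field_simp
    rw [this]
    ring
  · simp [hg, Set.indicator_of_notMem ht]

lemma tendsto_oscIntegral_one (lam y : ℝ) :
    Tendsto (fun σ ↦ oscIntegral lseriesExt lam y σ) (𝓝[>] 1)
      (𝓝 (oscIntegral lseriesExt lam y 1)) := by
  have hc : Continuous fun σ : ℝ ↦ oscIntegral lseriesExt lam y (max σ 1) := by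
    unfold oscIntegral
    refine intervalIntegral.continuous_parametric_intervalIntegral_of_continuous' ?_ 0 1
    refine Continuous.mul (by fun_prop) ?_
    refine continuousOn_lseriesExt.comp_continuous (by fun_prop) fun p ↦ ?_
    simp
  have := (hc.tendsto 1).mono_left (nhdsWithin_le_nhds (s := Set.Ioi 1))
  rw [max_self] at this
  refine this.congr' ?_
  filter_upwards [self_mem_nhdsWithin] with σ hσ
  rw [max_eq_left (le_of_lt hσ)]

lemma sum_vonMangoldt_div_le (s : Finset ℕ) (j : ℤ) :
    ∑ n ∈ s with ⌊Real.log (n : ℕ)⌋ = j, Λ n / n ≤ (Real.log 4 + 4) * Real.exp 1 := by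
  have hle (n : ℕ) (hn : n ∈ s.filter fun n : ℕ ↦ ⌊Real.log n⌋ = j) :
      Λ n / n ≤ Λ n * Real.exp (-j) := by
    rcases n.eq_zero_or_pos with rfl | h0
    · simp
    · have h1 := (Int.floor_eq_iff.1 (Finset.mem_filter.1 hn).2).1
      rw [Real.le_log_iff_exp_le (by positivity)] at h1
      rw [Real.exp_neg, div_eq_mul_inv]
      have := vonMangoldt_nonneg (n := n)
      gcongr
  calc _ ≤ ∑ n ∈ s with ⌊Real.log (n : ℕ)⌋ = j, Λ n * Real.exp (-j) := Finset.sum_le_sum hle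
    _ = (∑ n ∈ s with ⌊Real.log (n : ℕ)⌋ = j, Λ n) * Real.exp (-j) := by rw [Finset.sum_mul]
    _ ≤ Chebyshev.psi (Real.exp (j + 1)) * Real.exp (-j) := by
      gcongr
      rw [Chebyshev.psi_eq_sum_Icc]
      refine Finset.sum_le_sum_of_subset_of_nonneg (fun n hn ↦ ?_)
        fun _ _ _ ↦ vonMangoldt_nonneg
      rw [Finset.mem_Icc]
      refine ⟨n.zero_le, Nat.le_floor ?_⟩
      rcases n.eq_zero_or_pos with rfl | h0
      · simp [Real.exp_nonneg]
      · have h1 := (Int.floor_eq_iff.1 (Finset.mem_filter.1 hn).2).2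
        rw [Real.log_lt_iff_lt_exp (by positivity)] at h1
        exact h1.le
    _ ≤ (Real.log 4 + 4) * Real.exp (j + 1) * Real.exp (-j) := by
      gcongr
      exact Chebyshev.psi_le_const_mul_self (Real.exp_nonneg _)
    _ = _ := by
      rw [mul_assoc, ← Real.exp_add]
      congr 2
      ring

lemma summable_one_div_one_add_sq : Summable fun k : ℤ ↦ 1 / (1 + (k : ℝ) ^ 2) := by
  have h1 : Summable fun k : ℤ ↦ 1 / (k : ℝ) ^ 2 := Real.summable_one_div_int_pow.2 one_lt_two
  refine (h1.add (hasSum_pi_single (0 : ℤ) (1 : ℝ)).summable).of_nonneg_of_le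
    (fun k ↦ by positivity) fun k ↦ ?_
  rcases eq_or_ne k 0 with rfl | hk
  · simp
  · have : (0 : ℝ) < (k : ℝ) ^ 2 := by positivity
    rw [Pi.single_eq_of_ne hk, add_zero]
    gcongr
    linarith

lemma sum_vonMangoldt_div_mul_le {w : ℤ → ℝ} (hw0 : ∀ k, 0 ≤ w k) (hw : Summable w) (m : ℤ)
    (s : Finset ℕ) :
    ∑ n ∈ s, Λ n / n * w (⌊Real.log n⌋ - m) ≤
      (Real.log 4 + 4) * Real.exp 1 * ∑' k, w k := by
  have hw' : Summable fun k : ℤ ↦ w (k - m) := (Equiv.subRight m).summable_iff.2 hw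
  have htsum : ∑' k : ℤ, w (k - m) = ∑' k, w k := (Equiv.subRight m).tsum_eq w
  have hC : 0 ≤ (Real.log 4 + 4) * Real.exp 1 := by
    have := Real.log_nonneg (show (1 : ℝ) ≤ 4 by norm_num)
    positivity
  rw [← htsum, ← Finset.sum_fiberwise_of_maps_to
    (g := fun n : ℕ ↦ ⌊Real.log n⌋)
      (fun n hn ↦ Finset.mem_image_of_mem (fun n : ℕ ↦ ⌊Real.log n⌋) hn)]
  calc _ = ∑ j ∈ s.image fun n : ℕ ↦ ⌊Real.log n⌋,
        (∑ n ∈ s with ⌊Real.log (n : ℕ)⌋ = j, Λ n / n) * w (j - m) := by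
        refine Finset.sum_congr rfl fun j _ ↦ ?_
        rw [Finset.sum_mul]
        refine Finset.sum_congr rfl fun n hn ↦ ?_
        rw [(Finset.mem_filter.1 hn).2]
    _ ≤ ∑ j ∈ s.image fun n : ℕ ↦ ⌊Real.log n⌋,
        (Real.log 4 + 4) * Real.exp 1 * w (j - m) := by
        gcongr with j
        · exact hw0 _
        · exact sum_vonMangoldt_div_le s j
    _ ≤ _ := by
        rw [← Finset.mul_sum]
        gcongr
        exact hw'.sum_le_tsum _ fun _ _ ↦ hw0 _

lemma exists_sum_vonMangoldt_mul_fejer_le {δ : ℝ} (hδ : 0 < δ) :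
    ∃ C : ℝ, 0 ≤ C ∧ ∀ lam y σ : ℝ, 0 < lam → 1 ≤ σ →
      (∀ n : ℕ, IsPrimePow n → δ ≤ |y - Real.log n|) → ∀ s : Finset ℕ,
      ∑ n ∈ s, Λ n * (n : ℝ) ^ (-σ) * fejer (lam * (y - Real.log n)) ≤ C / lam ^ 2 := by
  set K : ℝ := 1 / δ ^ 2 + (1 + 1 / δ) ^ 2 with hK
  set C₀ : ℝ := (Real.log 4 + 4) * Real.exp 1
  have hC₀pos : 0 ≤ C₀ := by have := Real.log_nonneg (show (1 : ℝ) ≤ 4 by norm_num); positivity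
  set w : ℤ → ℝ := fun k ↦ 1 / (1 + (k : ℝ) ^ 2) with hw
  have hw0 (k : ℤ) : 0 ≤ w k := by simp only [hw]; positivity
  refine ⟨2 * K * (C₀ * ∑' k, w k), ?_, fun lam y σ hlam hσ hy s ↦ ?_⟩
  · have : 0 ≤ ∑' k, w k := tsum_nonneg hw0
    positivity
  have hterm (n : ℕ) : Λ n * (n : ℝ) ^ (-σ) * fejer (lam * (y - Real.log n)) ≤
      2 * K / lam ^ 2 * (Λ n / n * w (⌊Real.log n⌋ - ⌊y⌋)) := by
    by_cases hn : IsPrimePow n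
    swap
    · simp [vonMangoldt_eq_zero_iff.2 hn]
    have hv := hy n hn
    set v := y - Real.log n with hvdef
    have hn1 : (1 : ℝ) ≤ n := by exact_mod_cast hn.pos
    have hv0 : v ≠ 0 := fun h ↦ by rw [h, abs_zero] at hv; linarith
    have hfloor : |((⌊Real.log n⌋ - ⌊y⌋ : ℤ) : ℝ)| ≤ |v| + 1 := by
      push_cast
      have h1 := Int.floor_le (Real.log n)
      have h2 := Int.lt_floor_add_one (Real.log n)
      have h3 := Int.floor_le y
      have h4 := Int.lt_floor_add_one y
      have h5 := neg_abs_le v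
      have h6 := le_abs_self v
      rw [abs_le]
      constructor <;> linarith
    have hKv : 1 + ((⌊Real.log n⌋ - ⌊y⌋ : ℤ) : ℝ) ^ 2 ≤ K * v ^ 2 := by
      have h1 : 1 ≤ |v| / δ := by rwa [le_div_iff₀ hδ, one_mul]
      have h2 : ((⌊Real.log n⌋ - ⌊y⌋ : ℤ) : ℝ) ^ 2 ≤ (|v| + |v| / δ) ^ 2 := by
        rw [← sq_abs ((⌊Real.log n⌋ - ⌊y⌋ : ℤ) : ℝ)]
        gcongr
        linarith
      have h3 : 1 ≤ (|v| / δ) ^ 2 := one_le_pow₀ h1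
      have h4 : K * v ^ 2 = (|v| / δ) ^ 2 + (|v| + |v| / δ) ^ 2 := by
        rw [hK, ← sq_abs v]
        field_simp
      linarith
    have hwv : 2 / (lam * v) ^ 2 ≤ 2 * K / lam ^ 2 * w (⌊Real.log n⌋ - ⌊y⌋) := by
      have hv2 : 0 < v ^ 2 := by positivity
      simp only [hw]
      rw [mul_pow, div_mul_div_comm, mul_one, div_le_div_iff₀ (by positivity) (by positivity)]
      have : 0 < lam ^ 2 := by positivity
      nlinarith [mul_le_mul_of_nonneg_left hKv this.le]
    have hpow : (n : ℝ) ^ (-σ) ≤ 1 / n := by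
      rw [one_div, ← Real.rpow_neg_one]
      exact Real.rpow_le_rpow_of_exponent_le hn1 (by linarith)
    have hΛ := vonMangoldt_nonneg (n := n)
    calc _ ≤ Λ n * (1 / n) * (2 * K / lam ^ 2 * w (⌊Real.log n⌋ - ⌊y⌋)) := by
          gcongr
          · exact fejer_nonneg _
          · exact (fejer_le (mul_ne_zero hlam.ne' hv0)).trans hwv
      _ = _ := by ring
  have hsum := sum_vonMangoldt_div_mul_le hw0 summable_one_div_one_add_sq ⌊y⌋ s
  calc _ ≤ ∑ n ∈ s, 2 * K / lam ^ 2 * (Λ n / n * w (⌊Real.log n⌋ - ⌊y⌋)) :=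
        Finset.sum_le_sum fun n _ ↦ hterm n
    _ ≤ 2 * K / lam ^ 2 * (C₀ * ∑' k, w k) := by
        rw [← Finset.mul_sum]
        gcongr
    _ = _ := by ring

lemma exists_finset_sum_inv_ge {lam z : ℝ} (hlam : 1 ≤ lam) (hz : 2 * lam ≤ z) :
    ∃ s : Finset ℕ, 1 / (4 * lam) ≤ ∑ n ∈ s, (n : ℝ) ^ (-1 : ℝ) ∧
      ∀ n ∈ s, |lam * (Real.log z - Real.log n)| ≤ 1 := by
  have hl : 0 < lam := by linarith
  have hz0 : 0 < z := by linarith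
  have hmem (n : ℕ) (hn : n ∈ Finset.Ioc ⌊z⌋₊ ⌊z * (1 + 1 / lam)⌋₊) :
      z ≤ n ∧ (n : ℝ) ≤ z * (1 + 1 / lam) := by
    rw [Finset.mem_Ioc, Nat.floor_lt hz0.le, Nat.le_floor_iff (by positivity)] at hn
    exact ⟨hn.1.le, hn.2⟩
  refine ⟨Finset.Ioc ⌊z⌋₊ ⌊z * (1 + 1 / lam)⌋₊, ?_, fun n hn ↦ ?_⟩
  · have hterm : ∀ n ∈ Finset.Ioc ⌊z⌋₊ ⌊z * (1 + 1 / lam)⌋₊, 1 / (2 * z) ≤ (n : ℝ) ^ (-1 : ℝ) := by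
      intro n hn
      obtain ⟨h1, h2⟩ := hmem n hn
      rw [Real.rpow_neg_one, ← one_div]
      have : 1 / lam ≤ 1 := by rw [div_le_one hl]; exact hlam
      have hn0 : (0 : ℝ) < n := by linarith
      gcongr
      nlinarith
    have hcard := Finset.card_nsmul_le_sum _ _ _ hterm
    rw [Nat.card_Ioc, nsmul_eq_mul] at hcard
    refine le_trans ?_ hcard
    have h1 : z / (2 * lam) ≤ ((⌊z * (1 + 1 / lam)⌋₊ - ⌊z⌋₊ : ℕ) : ℝ) := by
      have h2 := Nat.floor_le hz0.le
      have h3 := Nat.lt_floor_add_one (z * (1 + 1 / lam))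
      rw [Nat.cast_sub (Nat.floor_mono (by
        have : 0 ≤ 1 / lam := by positivity
        nlinarith))]
      have h4 : 1 ≤ z / (2 * lam) := by rwa [le_div_iff₀ (by positivity), one_mul]
      have h5 : z * (1 + 1 / lam) = z + 2 * (z / (2 * lam)) := by field_simp
      linarith
    calc 1 / (4 * lam) = z / (2 * lam) * (1 / (2 * z)) := by field_simp; norm_num
      _ ≤ _ := by gcongr
  · obtain ⟨h1, h2⟩ := hmem n hn
    have hn0 : (0 : ℝ) < n := by linarith
    have h3 := Real.log_le_log hz0 h1
    have h4 := Real.log_le_log hn0 h2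
    rw [Real.log_mul hz0.ne' (by positivity)] at h4
    have h5 := Real.log_le_sub_one_of_pos (show 0 < 1 + 1 / lam by positivity)
    rw [abs_mul, abs_of_pos hl, abs_of_nonpos (by linarith), ← le_div_iff₀' hl]
    linarith

lemma sum_inv_mul_fejer_le {lam y C : ℝ}
    (hC : ∀ σ : ℝ, 1 < σ → ∀ s : Finset ℕ,
      ∑ n ∈ s, Λ n * (n : ℝ) ^ (-σ) * fejer (lam * (y - Real.log n)) ≤ C) (s : Finset ℕ) :
    ∑ n ∈ s, (n : ℝ) ^ (-1 : ℝ) * fejer (lam * (y - Real.log n)) ≤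
      C - (oscIntegral lseriesExt lam y 1).re := by
  have hleft : Tendsto
      (fun σ : ℝ ↦ ∑ n ∈ s, (n : ℝ) ^ (-σ) * fejer (lam * (y - Real.log n))) (𝓝[>] 1)
      (𝓝 (∑ n ∈ s, (n : ℝ) ^ (-1 : ℝ) * fejer (lam * (y - Real.log n)))) := by
    refine tendsto_finsetSum _ fun n _ ↦ Tendsto.mul_const _ ?_
    rcases eq_or_ne n 0 with rfl | hn
    · refine tendsto_const_nhds.congr' ?_
      filter_upwards [self_mem_nhdsWithin] with σ hσ
      have : -σ ≠ 0 := neg_ne_zero.2 (zero_lt_one.trans hσ).ne'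
      rw [Nat.cast_zero, Real.zero_rpow this, Real.zero_rpow (by norm_num)]
    · refine Tendsto.mono_left ?_ nhdsWithin_le_nhds
      exact (continuousAt_const.rpow continuousAt_id.neg (.inl (by exact_mod_cast hn)) :
        ContinuousAt (fun σ : ℝ ↦ (n : ℝ) ^ (-σ)) 1)
  have hright : Tendsto (fun σ : ℝ ↦ C - (oscIntegral lseriesExt lam y σ).re) (𝓝[>] 1)
      (𝓝 (C - (oscIntegral lseriesExt lam y 1).re)) :=
    ((continuous_re.tendsto _).comp (tendsto_oscIntegral_one lam y)).const_sub C
  refine le_of_tendsto_of_tendsto hleft hright ?_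
  filter_upwards [self_mem_nhdsWithin] with σ hσ
  rw [Set.mem_Ioi] at hσ
  have hosc : oscIntegral lseriesExt lam y σ =
      oscIntegral (LSeries fun n ↦ ((Λ n - 1 : ℝ) : ℂ)) lam y σ := by
    refine intervalIntegral.integral_congr fun t _ ↦ ?_
    rw [lseriesExt_eq (by simpa using hσ)]
  have hsum := hasSum_mul_fejer (by linarith)
    (lseriesSummable_vonMangoldt_sub_one (s := σ) (by simpa using hσ)) lam y
  rw [← hosc] at hsum
  have hone : Summable fun n : ℕ ↦ (n : ℝ) ^ (-σ) * fejer (lam * (y - Real.log n)) := by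
    refine (Real.summable_nat_rpow.2 (show -σ < -1 by linarith)).of_nonneg_of_le
      (fun n ↦ mul_nonneg (by positivity) (fejer_nonneg _)) fun n ↦ ?_
    refine mul_le_of_le_one_right (by positivity) ?_
    linarith [fejer_le_half (lam * (y - Real.log n))]
  have hΛ := hsum.add hone.hasSum
  have hle := hasSum_le_of_sum_le (hΛ.congr_fun (g := fun n : ℕ ↦
    Λ n * (n : ℝ) ^ (-σ) * fejer (lam * (y - Real.log n))) fun n ↦ by ring) (hC σ hσ)
  have := hone.sum_le_tsum s fun n _ ↦ mul_nonneg (by positivity) (fejer_nonneg _)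
  linarith

/-- The interval `[(1 - ε) x, x]` contains a prime power once `x` is large. -/
theorem eventually_exists_isPrimePow {ε : ℝ} (hε : 0 < ε) (hε1 : ε < 1) :
    ∀ᶠ x : ℕ in atTop, ∃ m, IsPrimePow m ∧ m ≤ x ∧ (1 - ε) * x ≤ m := by
  set a : ℝ := 1 - ε / 2 with ha
  have ha0 : 0 < a := by linarith
  have hb0 : 0 < 1 - ε := by linarith
  set δ := min (Real.log a - Real.log (1 - ε)) (-Real.log a) with hδdef
  have hδ : 0 < δ := by
    refine lt_min (sub_pos.2 (Real.log_lt_log hb0 (by linarith))) ?_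
    exact neg_pos.2 (Real.log_neg ha0 (by linarith))
  obtain ⟨C, hC0, hC⟩ := exists_sum_vonMangoldt_mul_fejer_le hδ
  set lam : ℝ := 32 * C + 1 with hlamdef
  have hlam1 : 1 ≤ lam := by linarith
  have hlam : 0 < lam := by linarith
  have htop : Tendsto (fun x : ℕ ↦ a * (x : ℝ)) atTop atTop :=
    tendsto_natCast_atTop_atTop.const_mul_atTop ha0
  have hosc := ((tendsto_oscIntegral_atTop hlam).comp (Real.tendsto_log_atTop.comp htop)).norm
  rw [norm_zero] at hosc
  filter_upwards [hosc.eventually_lt_const (show 0 < 1 / (32 * lam) by positivity),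
    htop.eventually_ge_atTop (2 * lam), eventually_gt_atTop 0] with x hx1 hx2 hx0
  by_contra! hno
  simp only [Function.comp] at hx1
  have hx : (0 : ℝ) < x := by exact_mod_cast hx0
  set y := Real.log (a * x) with hy
  have hy' : y = Real.log a + Real.log x := Real.log_mul ha0.ne' hx.ne'
  have hgap (n : ℕ) (hn : IsPrimePow n) : δ ≤ |y - Real.log n| := by
    have hn0 : (0 : ℝ) < n := by exact_mod_cast hn.pos
    by_cases hnx : n ≤ x
    · have h1 := Real.log_le_log hn0 (hno n hn hnx).le
      rw [Real.log_mul hb0.ne' hx.ne'] at h1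
      refine (min_le_left _ _).trans (le_trans ?_ (le_abs_self _))
      linarith
    · have h1 := Real.log_le_log hx (by exact_mod_cast (not_le.1 hnx).le : (x : ℝ) ≤ n)
      refine (min_le_right _ _).trans (le_trans ?_ (neg_le_abs _))
      linarith
  obtain ⟨s, hs1, hs2⟩ := exists_finset_sum_inv_ge hlam1 hx2
  have hmain := sum_inv_mul_fejer_le (fun σ hσ ↦ hC lam y σ hlam hσ.le hgap) s
  have hlow : (∑ n ∈ s, (n : ℝ) ^ (-1 : ℝ)) * (1 / 4) ≤
      ∑ n ∈ s, (n : ℝ) ^ (-1 : ℝ) * fejer (lam * (y - Real.log n)) := by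
    rw [Finset.sum_mul]
    gcongr with n hn
    exact quarter_le_fejer (hs2 n hn)
  have hre := (neg_le_abs _).trans (abs_re_le_norm (oscIntegral lseriesExt lam y 1))
  have hCl : C / lam ^ 2 ≤ 1 / (32 * lam) := by
    rw [div_le_div_iff₀ (by positivity) (by positivity)]
    nlinarith
  have h4 : 1 / (4 * lam) = 8 * (1 / (32 * lam)) := by field_simp; norm_num
  linarith

lemma le_q {m x : ℕ} (hm : IsPrimePow m) (hmx : m ≤ x) : m ≤ q x :=
  le_csSup ⟨x, fun _ h ↦ h.2⟩ ⟨.inl hm, hmx⟩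

theorem stmt_2 (ε : ℝ) (hε : 0 < ε) :
    ∃ X₀ : ℕ, 0 < X₀ ∧ ∀ x : ℕ, X₀ ≤ x → ¬ IsPrimePow x → (P x : ℝ) ≤ ε * x := by
  have hε' : 0 < min ε (1 / 2) := lt_min hε (by norm_num)
  obtain ⟨X, hX⟩ := eventually_atTop.1
    (eventually_exists_isPrimePow hε' ((min_le_right _ _).trans_lt (by norm_num)))
  refine ⟨X + 2, by omega, fun x hx hpp ↦ ?_⟩
  obtain ⟨m, hm, hmx, hmε⟩ := hX x (by omega)
  rw [P, if_neg (by omega), if_neg hpp]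
  have h1 : ((x - q x : ℕ) : ℝ) ≤ ((x - m : ℕ) : ℝ) := by
    exact_mod_cast Nat.sub_le_sub_left (le_q hm hmx) x
  rw [Nat.cast_sub hmx] at h1
  have h2 : min ε (1 / 2) * x ≤ ε * x := by
    gcongr
    exact min_le_left _ _
  linarith
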